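/- Let n ≥ 1, let φ be a norm on ℝⁿ, let Ω ⊆ ℝⁿ be a nonempty open set of finite Lebesgue measure, and let m ≥ 0. Then there exists a minimizer of problem (1): there is an admissible function u ∈ BV(ℝⁿ) (u = 0 a.e. on ℝⁿ∖Ω, u(x) ∈ ℕ for a.e. x, ∫_Ω u dx = m) whose anisotropic total variation ∫_Ω φ*(Du) equals the infimum of the anisotropic total variation over all admissible functions. -/

import Mathlib

open MeasureTheory Set ENNReal Filter

noncomputable section

/-- `φ` is a norm on `ℝⁿ` (represented as `Fin n → ℝ`). -/
structure IsNorm {n : ℕ} (φ : (Fin n → ℝ) → ℝ) : Prop where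
  nonneg : ∀ x, 0 ≤ φ x
  eq_zero_iff : ∀ x, φ x = 0 ↔ x = 0
  smul_eq : ∀ (a : ℝ) (x : Fin n → ℝ), φ (a • x) = |a| * φ x
  add_le : ∀ x y, φ (x + y) ≤ φ x + φ y

/-- The divergence of a vector field `η : ℝⁿ → ℝⁿ`. -/
def diverg {n : ℕ} (η : (Fin n → ℝ) → (Fin n → ℝ)) (x : Fin n → ℝ) : ℝ :=
  ∑ i, fderiv ℝ η x (Pi.single i 1) i

/-- The anisotropic total variation `∫ φ*(Du)` of `u : ℝⁿ → ℝ`: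
`sup { ∫ u div η dx : η ∈ C¹_c(ℝⁿ;ℝⁿ), φ(η(x)) ≤ 1 ∀ x }`, as an extended real. -/
def anisoTV {n : ℕ} (φ : (Fin n → ℝ) → ℝ) (u : (Fin n → ℝ) → ℝ) : ℝ≥0∞ :=
  ⨆ η ∈ {η : (Fin n → ℝ) → (Fin n → ℝ) |
      ContDiff ℝ 1 η ∧ HasCompactSupport η ∧ ∀ x, φ (η x) ≤ 1},
    ENNReal.ofReal (∫ x, u x * diverg η x)

/-- `u ∈ BV(ℝⁿ)` (with respect to the anisotropic total variation). -/
def IsBV {n : ℕ} (φ : (Fin n → ℝ) → ℝ) (u : (Fin n → ℝ) → ℝ) : Prop :=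
  Integrable u volume ∧ anisoTV φ u ≠ ⊤

/-- `u` is admissible for problem (1): `u ∈ BV(ℝⁿ)`, `u = 0` a.e. outside `Ω`,
`u` is a.e. `ℕ`-valued, and `∫_Ω u = m`. -/
def Admissible {n : ℕ} (φ : (Fin n → ℝ) → ℝ) (Ω : Set (Fin n → ℝ)) (m : ℝ)
    (u : (Fin n → ℝ) → ℝ) : Prop :=
  IsBV φ u ∧ (∀ᵐ x ∂volume, x ∉ Ω → u x = 0) ∧
    (∀ᵐ x ∂volume, ∃ k : ℕ, u x = k) ∧ (∫ x in Ω, u x) = m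

/-- `u` is a minimizer of problem (1). -/
def IsMinimizer {n : ℕ} (φ : (Fin n → ℝ) → ℝ) (Ω : Set (Fin n → ℝ)) (m : ℝ)
    (u : (Fin n → ℝ) → ℝ) : Prop :=
  Admissible φ Ω m u ∧ ∀ v, Admissible φ Ω m v → anisoTV φ u ≤ anisoTV φ v

/-- The anisotropic perimeter `P_φ(E)` of a set `E ⊆ ℝⁿ`. -/
def anisoPerimeter {n : ℕ} (φ : (Fin n → ℝ) → ℝ) (E : Set (Fin n → ℝ)) : ℝ≥0∞ :=
  anisoTV φ (E.indicator (1 : (Fin n → ℝ) → ℝ))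

/-- The Wulff ball `W_r(x) = {y : φ(y-x) < r}`. -/
def wulffBall {n : ℕ} (φ : (Fin n → ℝ) → ℝ) (x : Fin n → ℝ) (r : ℝ) : Set (Fin n → ℝ) :=
  {y | φ (y - x) < r}

/-- `E` satisfies the `rW_φ`-condition. -/
def rWCond {n : ℕ} (φ : (Fin n → ℝ) → ℝ) (E : Set (Fin n → ℝ)) (r : ℝ) : Prop :=
  ∀ x ∈ frontier E, ∃ y, wulffBall φ y r ⊆ E ∧ x ∈ frontier (wulffBall φ y r)

/-- The Wulff plaquette `E^r`, the union of all Wulff balls of radius `r` contained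
in `E` (with `E^0 = E`). -/
def plaquette {n : ℕ} (φ : (Fin n → ℝ) → ℝ) (E : Set (Fin n → ℝ)) (r : ℝ) :
    Set (Fin n → ℝ) :=
  if r = 0 then E else ⋃ (x) (_ : wulffBall φ x r ⊆ E), wulffBall φ x r

/-- `R_Ω`: the maximal `R > 0` such that some Wulff ball of radius `R` is contained in `Ω`. -/
def maxInradius {n : ℕ} (φ : (Fin n → ℝ) → ℝ) (Ω : Set (Fin n → ℝ)) : ℝ :=
  sSup {R | 0 < R ∧ ∃ x, wulffBall φ x R ⊆ Ω}

/-- `r_Ω`: the maximal `r > 0` such that `Ω` satisfies the `rW_φ`-condition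
(`0` if there is none, since `sSup ∅ = 0`). -/
def maxRollRadius {n : ℕ} (φ : (Fin n → ℝ) → ℝ) (Ω : Set (Fin n → ℝ)) : ℝ :=
  sSup {r | 0 < r ∧ rWCond φ Ω r}

/-- The set of points of Lebesgue density `1` of `E`. -/
def densityPoints {n : ℕ} (E : Set (Fin n → ℝ)) : Set (Fin n → ℝ) :=
  {x | Tendsto (fun r : ℝ => volume (E ∩ Metric.ball x r) / volume (Metric.ball x r))
    (nhdsWithin 0 (Ioi 0)) (nhds 1)}

/-- `E` is a minimizer of problem (10): the constrained isoperimetric problem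
minimizing `P_φ` among measurable subsets of `Ω` of prescribed measure `m`. -/
def IsIsopMinimizer {n : ℕ} (φ : (Fin n → ℝ) → ℝ) (Ω : Set (Fin n → ℝ)) (m : ℝ)
    (E : Set (Fin n → ℝ)) : Prop :=
  MeasurableSet E ∧ E ⊆ Ω ∧ (volume E).toReal = m ∧
    ∀ F, MeasurableSet F → F ⊆ Ω → (volume F).toReal = m →
      anisoPerimeter φ E ≤ anisoPerimeter φ F

/-- The Euclidean norm on `ℝ²`. -/
def euclNorm (v : Fin 2 → ℝ) : ℝ := Real.sqrt (v 0 ^ 2 + v 1 ^ 2)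

/-- The crystalline norm `φ(ν) = |ν₁| + |ν₂|` on `ℝ²`. -/
def crysNorm (v : Fin 2 → ℝ) : ℝ := |v 0| + |v 1|

/-- The open unit square `(0,1)² ⊆ ℝ²`. -/
def unitSquare : Set (Fin 2 → ℝ) := univ.pi fun _ => Ioo (0 : ℝ) 1

/-- The closed unit square `[0,1]² ⊆ ℝ²`. -/
def closedUnitSquare : Set (Fin 2 → ℝ) := univ.pi fun _ => Icc (0 : ℝ) 1

/-- `j` is the essential supremum `‖u‖_∞` of `u`. -/
def IsEssSup (u : (Fin 2 → ℝ) → ℝ) (j : ℕ) : Prop :=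
  (∀ᵐ x ∂volume, u x ≤ (j : ℝ)) ∧ ∀ c : ℝ, (∀ᵐ x ∂volume, u x ≤ c) → (j : ℝ) ≤ c

open scoped Topology

namespace IsNorm

variable {n : ℕ} {φ : (Fin n → ℝ) → ℝ}

lemma neg_eq (hφ : IsNorm φ) (x : Fin n → ℝ) : φ (-x) = φ x := by
  simpa using hφ.smul_eq (-1) x

lemma sum_le (hφ : IsNorm φ) {ι : Type*} (s : Finset ι) (f : ι → Fin n → ℝ) :
    φ (∑ i ∈ s, f i) ≤ ∑ i ∈ s, φ (f i) :=
  Finset.le_sum_of_subadditive φ ((hφ.eq_zero_iff 0).2 rfl).le hφ.add_le s f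

lemma exists_le_mul_norm (hφ : IsNorm φ) : ∃ C, 0 ≤ C ∧ ∀ x, φ x ≤ C * ‖x‖ := by
  refine ⟨∑ i, φ (Pi.single i 1), Finset.sum_nonneg fun i _ => hφ.nonneg _, fun x => ?_⟩
  have hx : x = ∑ i, x i • (Pi.single i 1 : Fin n → ℝ) := pi_eq_sum_univ' x
  calc φ x = φ (∑ i, x i • (Pi.single i 1 : Fin n → ℝ)) := congrArg φ hx
    _ ≤ ∑ i, φ (x i • (Pi.single i 1 : Fin n → ℝ)) := hφ.sum_le _ _
    _ ≤ ∑ i, φ (Pi.single i 1) * ‖x‖ := Finset.sum_le_sum fun i _ => by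
        rw [hφ.smul_eq, mul_comm]
        exact mul_le_mul_of_nonneg_left (norm_le_pi_norm x i) (hφ.nonneg _)
    _ = (∑ i, φ (Pi.single i 1)) * ‖x‖ := (Finset.sum_mul _ _ _).symm

lemma continuous (hφ : IsNorm φ) : Continuous φ := by
  obtain ⟨C, hC, h⟩ := hφ.exists_le_mul_norm
  refine (LipschitzWith.of_dist_le_mul (K := C.toNNReal) fun x y => ?_).continuous
  rw [Real.coe_toNNReal _ hC, Real.dist_eq, dist_eq_norm x y, abs_sub_le_iff]
  have h1 := hφ.add_le (x - y) y
  have h2 := hφ.add_le (y - x) x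
  rw [sub_add_cancel] at h1 h2
  have h3 := h (x - y)
  have h4 := h (y - x)
  rw [norm_sub_rev] at h4
  constructor <;> linarith

lemma exists_norm_le_mul (hφ : IsNorm φ) : ∃ c, 0 ≤ c ∧ ∀ x, ‖x‖ ≤ c * φ x := by
  rcases (Metric.sphere (0 : Fin n → ℝ) 1).eq_empty_or_nonempty with hS | hS
  · refine ⟨0, le_rfl, fun x => ?_⟩
    by_contra! hx
    rw [zero_mul] at hx
    have : ‖x‖⁻¹ • x ∈ Metric.sphere (0 : Fin n → ℝ) 1 := by
      simp [norm_smul, hx.ne']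
    simp [hS] at this
  · obtain ⟨y, hy, hmin⟩ := (isCompact_sphere (0 : Fin n → ℝ) 1).exists_isMinOn hS
      hφ.continuous.continuousOn
    have hy0 : 0 < φ y := lt_of_le_of_ne (hφ.nonneg y) fun h => by
      have := (hφ.eq_zero_iff y).1 h.symm
      simp [this] at hy
    refine ⟨(φ y)⁻¹, inv_nonneg.2 hy0.le, fun x => ?_⟩
    rcases eq_or_ne x 0 with rfl | hx
    · simpa using mul_nonneg (inv_nonneg.2 hy0.le) (hφ.nonneg 0)
    have hx' : 0 < ‖x‖ := norm_pos_iff.2 hx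
    have hmem : ‖x‖⁻¹ • x ∈ Metric.sphere (0 : Fin n → ℝ) 1 := by
      simp [norm_smul, hx'.ne']
    have h := hmin hmem
    simp only [mem_ofPred_eq, hφ.smul_eq, abs_inv, abs_norm] at h
    rw [inv_mul_eq_div, le_div_iff₀ hx'] at h
    rw [inv_mul_eq_div, le_div_iff₀ hy0]
    linarith

end IsNorm

section Divergence

variable {n : ℕ} {φ : (Fin n → ℝ) → ℝ} {u : (Fin n → ℝ) → ℝ}

lemma diverg_const_smul {η : (Fin n → ℝ) → (Fin n → ℝ)} (hη : ContDiff ℝ 1 η) (c : ℝ)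
    (x : Fin n → ℝ) : diverg (fun y => c • η y) x = c * diverg η x := by
  have : fderiv ℝ (fun y => c • η y) x = c • fderiv ℝ η x :=
    fderiv_const_smul (hη.differentiable one_ne_zero x) c
  simp [diverg, this, Finset.mul_sum]

lemma diverg_smul_const {f : (Fin n → ℝ) → ℝ} {x : Fin n → ℝ} (hf : DifferentiableAt ℝ f x)
    (h : Fin n → ℝ) : diverg (fun y => f y • h) x = fderiv ℝ f x h := by
  rw [diverg, fderiv_smul_const hf]
  conv_rhs => rw [pi_eq_sum_univ' h]
  simp only [map_sum, map_smul, ContinuousLinearMap.smulRight_apply, Pi.smul_apply, smul_eq_mul]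
  refine Finset.sum_congr rfl fun i _ => ?_
  rw [mul_comm]

lemma continuous_diverg {η : (Fin n → ℝ) → (Fin n → ℝ)} (hη : ContDiff ℝ 1 η) :
    Continuous (diverg η) := by
  have := hη.continuous_fderiv one_ne_zero
  unfold diverg
  fun_prop

lemma hasCompactSupport_diverg {η : (Fin n → ℝ) → (Fin n → ℝ)} (hη : HasCompactSupport η) :
    HasCompactSupport (diverg η) :=
  (hη.fderiv (𝕜 := ℝ)).mono fun x hx h => hx (by simp [diverg, h])

lemma exists_norm_diverg_le {η : (Fin n → ℝ) → (Fin n → ℝ)} (hη : ContDiff ℝ 1 η)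
    (hc : HasCompactSupport η) : ∃ C, ∀ x, ‖diverg η x‖ ≤ C :=
  (hasCompactSupport_diverg hc).exists_bound_of_continuous (continuous_diverg hη)

lemma integral_mul_diverg_le (hTV : anisoTV φ u ≠ ⊤) {η : (Fin n → ℝ) → (Fin n → ℝ)}
    (hη : ContDiff ℝ 1 η) (hc : HasCompactSupport η) (h1 : ∀ x, φ (η x) ≤ 1) :
    ∫ x, u x * diverg η x ≤ (anisoTV φ u).toReal := by
  rw [← ENNReal.ofReal_le_iff_le_toReal hTV]
  exact le_iSup₂_of_le η ⟨hη, hc, h1⟩ le_rfl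

lemma integral_mul_diverg_le_mul (hφ : IsNorm φ) (hTV : anisoTV φ u ≠ ⊤)
    {η : (Fin n → ℝ) → (Fin n → ℝ)} (hη : ContDiff ℝ 1 η) (hc : HasCompactSupport η) {c : ℝ}
    (hc0 : 0 < c) (h1 : ∀ x, φ (η x) ≤ c) :
    ∫ x, u x * diverg η x ≤ c * (anisoTV φ u).toReal := by
  have := integral_mul_diverg_le hTV (η := fun x => c⁻¹ • η x) (hη.const_smul _)
    (hc.comp_left (g := fun v => c⁻¹ • v) (smul_zero _)) fun x => by
      rw [hφ.smul_eq, abs_inv, abs_of_pos hc0, inv_mul_le_iff₀ hc0, mul_one]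
      exact h1 x
  simp_rw [diverg_const_smul hη, mul_left_comm _ c⁻¹] at this
  rwa [integral_const_mul, inv_mul_le_iff₀ hc0] at this

lemma abs_integral_mul_diverg_le_mul (hφ : IsNorm φ) (hTV : anisoTV φ u ≠ ⊤)
    {η : (Fin n → ℝ) → (Fin n → ℝ)} (hη : ContDiff ℝ 1 η) (hc : HasCompactSupport η) {c : ℝ}
    (hc0 : 0 < c) (h1 : ∀ x, φ (η x) ≤ c) :
    |∫ x, u x * diverg η x| ≤ c * (anisoTV φ u).toReal := by
  refine abs_le.2 ⟨?_, integral_mul_diverg_le_mul hφ hTV hη hc hc0 h1⟩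
  have := integral_mul_diverg_le_mul hφ hTV (η := fun x => (-1 : ℝ) • η x) (hη.const_smul _)
    (hc.comp_left (g := fun v => (-1 : ℝ) • v) (smul_zero _)) hc0 fun x => by
      simpa [hφ.neg_eq] using h1 x
  simp_rw [diverg_const_smul hη, mul_left_comm _ (-1 : ℝ)] at this
  rw [integral_const_mul] at this
  linarith

end Divergence

section Translation

variable {n : ℕ} {φ : (Fin n → ℝ) → ℝ} {u : (Fin n → ℝ) → ℝ}

lemma integral_mul_translate_sub_le (hφ : IsNorm φ) (hu : Integrable u) (hTV : anisoTV φ u ≠ ⊤)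
    {ψ : (Fin n → ℝ) → ℝ} (hψ : ContDiff ℝ 1 ψ) (hc : HasCompactSupport ψ) (h1 : ∀ x, |ψ x| ≤ 1)
    (h : Fin n → ℝ) :
    ∫ x, u x * (ψ (x - h) - ψ x) ≤ φ h * (anisoTV φ u).toReal := by
  rcases eq_or_ne h 0 with rfl | hh
  · simpa using mul_nonneg (hφ.nonneg 0) ENNReal.toReal_nonneg
  have hh0 : 0 < φ h := lt_of_le_of_ne (hφ.nonneg h) fun h0 => hh ((hφ.eq_zero_iff h).1 h0.symm)
  have hbdd : ∀ t : ℝ, Integrable (fun x => u x * ψ (x - t • h)) := fun t =>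
    hu.mul_bdd (c := 1) (by have := hψ.continuous; fun_prop) (.of_forall fun x => h1 _)
  obtain ⟨C, hC⟩ := (hc.fderiv (𝕜 := ℝ)).exists_bound_of_continuous
    (hψ.continuous_fderiv one_ne_zero)
  have hcd : ∀ t : ℝ, ContDiff ℝ 1 fun x => ψ (x - t • h) := fun t => by fun_prop
  have hder : ∀ t : ℝ, HasDerivAt (fun t : ℝ => ∫ x, u x * ψ (x - t • h))
      (∫ x, u x * -(fderiv ℝ ψ (x - t • h) h)) t := fun t => by
    refine (hasDerivAt_integral_of_dominated_loc_of_deriv_le (s := univ)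
      (F := fun t x => u x * ψ (x - t • h)) (F' := fun t x => u x * -(fderiv ℝ ψ (x - t • h) h))
      (bound := fun x => ‖u x‖ * (C * ‖h‖)) Filter.univ_mem
      (.of_forall fun s => (hbdd s).aestronglyMeasurable) (hbdd t) ?_ ?_ ?_ ?_).2
    · have := hψ.continuous_fderiv one_ne_zero
      exact hu.aestronglyMeasurable.mul (Continuous.aestronglyMeasurable (by fun_prop))
    · refine .of_forall fun x s _ => ?_
      rw [norm_mul, norm_neg]
      gcongr
      exact (ContinuousLinearMap.le_opNorm _ _).trans (by gcongr; exact hC _)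
    · exact hu.norm.mul_const _
    · refine .of_forall fun x s _ => ?_
      have hl : HasDerivAt (fun s : ℝ => x - s • h) (-h) s := by
        simpa using ((hasDerivAt_id s).smul_const h).const_sub x
      have := ((hψ.differentiable one_ne_zero (x - s • h)).hasFDerivAt.comp_hasDerivAt s hl)
      rw [map_neg] at this
      exact this.const_mul (u x)
  have hbound : ∀ t : ℝ, ‖∫ x, u x * -(fderiv ℝ ψ (x - t • h) h)‖ ≤
      φ h * (anisoTV φ u).toReal := fun t => by
    have hdiv : ∀ x, diverg (fun y => ψ (y - t • h) • h) x = fderiv ℝ ψ (x - t • h) h := fun x => by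
      rw [diverg_smul_const ((hcd t).differentiable one_ne_zero x), fderiv_comp_sub]
    have hcs : HasCompactSupport fun y => ψ (y - t • h) :=
      hc.comp_homeomorph (Homeomorph.subRight (t • h))
    have := abs_integral_mul_diverg_le_mul hφ hTV (η := fun y => ψ (y - t • h) • h)
      ((hcd t).smul contDiff_const) hcs.smul_right hh0 fun x => by
        rw [hφ.smul_eq]
        exact mul_le_of_le_one_left hh0.le (h1 _)
    simp_rw [hdiv] at this
    simpa [integral_neg] using this
  have := Convex.norm_image_sub_le_of_norm_hasDerivWithin_le
    (fun t _ => (hder t).hasDerivWithinAt) (fun t _ => hbound t) convex_univ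
    (mem_univ (0 : ℝ)) (mem_univ (1 : ℝ))
  simp only [one_smul, zero_smul, sub_zero, norm_one, mul_one] at this
  have h0 := hbdd 0
  have h1' := hbdd 1
  simp only [one_smul, zero_smul, sub_zero] at h0 h1'
  simp_rw [mul_sub]
  rw [integral_sub h1' h0]
  exact (le_abs_self _).trans this

end Translation

section Duality

variable {n : ℕ} {φ : (Fin n → ℝ) → ℝ} {u : (Fin n → ℝ) → ℝ}

lemma tendsto_mul_div_sqrt (a : ℝ) :
    Tendsto (fun k : ℕ => a * (a / √(a ^ 2 + (1 / ((k : ℝ) + 1)) ^ 2))) atTop (𝓝 |a|) := by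
  rcases eq_or_ne a 0 with rfl | ha
  · simp
  have h := tendsto_one_div_add_atTop_nhds_zero_nat (𝕜 := ℝ)
  have h2 : Tendsto (fun k : ℕ => √(a ^ 2 + (1 / ((k : ℝ) + 1)) ^ 2)) atTop
      (𝓝 (√(a ^ 2 + 0 ^ 2))) := ((h.pow 2).const_add (a ^ 2)).sqrt
  have h3 : |a| = a * (a / √(a ^ 2 + 0 ^ 2)) := by
    rw [zero_pow two_ne_zero, add_zero, Real.sqrt_sq_eq_abs, ← mul_div_assoc,
      eq_div_iff (abs_ne_zero.2 ha), abs_mul_abs_self]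
  rw [h3]
  exact (tendsto_const_nhds.div h2 (by
    rw [zero_pow two_ne_zero, add_zero, Real.sqrt_sq_eq_abs]
    exact abs_ne_zero.2 ha)).const_mul a

lemma abs_div_sqrt_le_one (a b : ℝ) : |a / √(a ^ 2 + b ^ 2)| ≤ 1 := by
  rw [abs_div, abs_of_nonneg (Real.sqrt_nonneg _)]
  refine div_le_one_of_le₀ ?_ (Real.sqrt_nonneg _)
  rw [← Real.sqrt_sq_eq_abs]
  exact Real.sqrt_le_sqrt (by nlinarith [sq_nonneg b])

/-- The `L¹` norm is the supremum of the pairings with `C¹` compactly supported test functions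
bounded by one. -/
lemma integral_norm_le_of_forall_integral_mul_le {f : (Fin n → ℝ) → ℝ} (hf : Integrable f) {K : ℝ}
    (h : ∀ ψ : (Fin n → ℝ) → ℝ, ContDiff ℝ 1 ψ → HasCompactSupport ψ → (∀ x, |ψ x| ≤ 1) →
      ∫ x, f x * ψ x ≤ K) : ∫ x, ‖f x‖ ≤ K := by
  refine le_of_forall_pos_le_add fun ε hε => ?_
  obtain ⟨g, hgc, hgs, hfg⟩ := (memLp_one_iff_integrable.2 hf).exist_eLpNorm_sub_le
    ENNReal.one_ne_top le_rfl (half_pos hε)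
  have hg : Integrable g := hgs.continuous.integrable_of_hasCompactSupport hgc
  have hsub : Integrable fun x => f x - g x := hf.sub hg
  have hD : ∫ x, ‖f x - g x‖ ≤ ε / 2 := by
    rw [eLpNorm_one_eq_lintegral_enorm] at hfg
    rw [integral_norm_eq_lintegral_enorm hsub.aestronglyMeasurable]
    exact ENNReal.toReal_le_of_le_ofReal (half_pos hε).le hfg
  have hk : ∀ k : ℕ, ∫ x, g x * (g x / √(g x ^ 2 + (1 / ((k : ℝ) + 1)) ^ 2)) ≤ K + ε / 2 := by
    intro k
    have hpos : ∀ x, g x ^ 2 + (1 / ((k : ℝ) + 1)) ^ 2 ≠ 0 := fun x => by positivity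
    have hg1 : ContDiff ℝ 1 g := hgs.of_le (by exact_mod_cast le_top)
    set ψ : (Fin n → ℝ) → ℝ := fun x => g x / √(g x ^ 2 + (1 / ((k : ℝ) + 1)) ^ 2) with hψ
    have hψ1 : ∀ x, |ψ x| ≤ 1 := fun x => abs_div_sqrt_le_one _ _
    have hψs : ContDiff ℝ 1 ψ := hg1.div (((hg1.pow 2).add contDiff_const).sqrt hpos)
      fun x => by positivity
    have hψc : HasCompactSupport ψ :=
      hgc.comp_left (g := fun a => a / √(a ^ 2 + (1 / ((k : ℝ) + 1)) ^ 2)) (zero_div _)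
    have hfi : Integrable (fun x => f x * ψ x) :=
      hf.mul_bdd (c := 1) hψs.continuous.aestronglyMeasurable (.of_forall hψ1)
    have hgi : Integrable (fun x => g x * ψ x) :=
      hg.mul_bdd (c := 1) hψs.continuous.aestronglyMeasurable (.of_forall hψ1)
    have h1 : ∫ x, (g x * ψ x - f x * ψ x) ≤ ∫ x, ‖f x - g x‖ :=
      integral_mono (hgi.sub hfi) hsub.norm fun x => by
        change g x * ψ x - f x * ψ x ≤ ‖f x - g x‖
        rw [← sub_mul, norm_sub_rev]
        refine (le_abs_self _).trans ?_
        rw [abs_mul]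
        exact mul_le_of_le_one_right (abs_nonneg _) (hψ1 x)
    rw [integral_sub hgi hfi] at h1
    have := h ψ hψs hψc hψ1
    linarith
  have hlim : Tendsto (fun k : ℕ => ∫ x, g x * (g x / √(g x ^ 2 + (1 / ((k : ℝ) + 1)) ^ 2))) atTop
      (𝓝 (∫ x, ‖g x‖)) := by
    refine tendsto_integral_of_dominated_convergence (fun x => ‖g x‖) (fun k => ?_) hg.norm
      (fun k => .of_forall fun x => ?_) (.of_forall fun x => tendsto_mul_div_sqrt _)
    · exact hg.aestronglyMeasurable.mul (Measurable.aestronglyMeasurable (by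
        have := hgs.continuous.measurable
        fun_prop))
    · rw [norm_mul]
      exact mul_le_of_le_one_right (norm_nonneg _) (abs_div_sqrt_le_one _ _)
  have hgK := le_of_tendsto' hlim hk
  have : ∫ x, ‖f x‖ ≤ ∫ x, (‖f x - g x‖ + ‖g x‖) :=
    integral_mono hf.norm (hsub.norm.add hg.norm) fun x => by
      simpa using norm_add_le (f x - g x) (g x)
  rw [integral_add hsub.norm hg.norm] at this
  linarith

/-- Translations are Lipschitz in `L¹` on functions of finite total variation. -/
lemma lintegral_enorm_translate_sub_le (hφ : IsNorm φ) (hu : Integrable u)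
    (hTV : anisoTV φ u ≠ ⊤) (h : Fin n → ℝ) :
    ∫⁻ x, ‖u x - u (x - h)‖ₑ ≤ ENNReal.ofReal (φ h * (anisoTV φ u).toReal) := by
  have huh : Integrable fun x => u (x - h) := hu.comp_sub_right h
  have hsub : Integrable fun x => u x - u (x - h) := hu.sub huh
  rw [← ofReal_integral_norm_eq_lintegral_enorm hsub]
  refine ENNReal.ofReal_le_ofReal ?_
  refine integral_norm_le_of_forall_integral_mul_le hsub fun ψ hψ hc h1 => ?_
  have hi : ∀ v : (Fin n → ℝ) → ℝ, Integrable v → Integrable (fun x => v x * ψ x) := fun v hv =>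
    hv.mul_bdd (c := 1) hψ.continuous.aestronglyMeasurable (.of_forall h1)
  have hi' : Integrable (fun x => u x * ψ (x - -h)) :=
    hu.mul_bdd (c := 1) (by have := hψ.continuous; fun_prop) (.of_forall fun x => h1 _)
  have key := integral_mul_translate_sub_le hφ hu hTV (ψ := fun x => -ψ x) hψ.neg
    (hc.comp_left (g := fun a => -a) neg_zero) (by simpa using h1) (-h)
  rw [hφ.neg_eq] at key
  refine le_trans (le_of_eq ?_) key
  have e1 : ∫ x, u (x - h) * ψ x = ∫ x, u x * ψ (x - -h) := by
    rw [← integral_sub_right_eq_self (fun x => u x * ψ (x - -h)) h]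
    simp
  simp only [sub_mul]
  rw [integral_sub (hi u hu) (hi _ huh), e1, ← integral_sub (hi u hu) hi']
  congr 1
  ext x
  ring

end Duality

section CubeAverage

variable {n : ℕ}

/-- The index of the half-open cube of side `δ` of the lattice grid that contains `x`. -/
def cubeIndex (δ : ℝ) (x : Fin n → ℝ) : Fin n → ℤ := fun i => ⌊x i / δ⌋

/-- The average of `u` over the grid cube of side `δ` that contains `x`. -/
def cubeAverage (δ : ℝ) (u : (Fin n → ℝ) → ℝ) (x : Fin n → ℝ) : ℝ :=
  (δ ^ n)⁻¹ * ∫ y in cubeIndex δ ⁻¹' {cubeIndex δ x}, u y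

lemma measurable_cubeIndex (δ : ℝ) : Measurable (cubeIndex δ : (Fin n → ℝ) → Fin n → ℤ) :=
  measurable_pi_lambda _ fun i =>
    Measurable.floor (f := fun x : Fin n → ℝ => x i / δ) (by fun_prop)

lemma measurableSet_cube (δ : ℝ) (z : Fin n → ℤ) :
    MeasurableSet (cubeIndex δ ⁻¹' {z} : Set (Fin n → ℝ)) :=
  measurable_cubeIndex δ (measurableSet_singleton z)

lemma cube_eq_pi {δ : ℝ} (hδ : 0 < δ) (z : Fin n → ℤ) :
    (cubeIndex δ ⁻¹' {z} : Set (Fin n → ℝ)) =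
      univ.pi fun i => Ico (δ * z i) (δ * z i + δ) := by
  ext x
  simp only [mem_preimage, mem_singleton_iff, funext_iff, cubeIndex, mem_univ_pi, mem_Ico,
    Int.floor_eq_iff]
  refine forall_congr' fun i => ?_
  rw [le_div_iff₀ hδ, div_lt_iff₀ hδ, add_mul, one_mul, mul_comm δ]

lemma volume_cube {δ : ℝ} (hδ : 0 < δ) (z : Fin n → ℤ) :
    volume (cubeIndex δ ⁻¹' {z} : Set (Fin n → ℝ)) = ENNReal.ofReal (δ ^ n) := by
  rw [cube_eq_pi hδ, Real.volume_pi_Ico, ENNReal.ofReal_pow hδ.le]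
  simp

lemma norm_sub_le_of_cubeIndex_eq {δ : ℝ} (hδ : 0 < δ) {x y : Fin n → ℝ}
    (h : cubeIndex δ y = cubeIndex δ x) : ‖x - y‖ ≤ δ := by
  have hx : x ∈ (cubeIndex δ ⁻¹' {cubeIndex δ x} : Set (Fin n → ℝ)) := rfl
  have hy : y ∈ (cubeIndex δ ⁻¹' {cubeIndex δ x} : Set (Fin n → ℝ)) := h
  rw [cube_eq_pi hδ, mem_univ_pi] at hx hy
  refine (pi_norm_le_iff_of_nonneg hδ.le).2 fun i => ?_
  rw [Pi.sub_apply, Real.norm_eq_abs, abs_sub_le_iff]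
  constructor <;> linarith [(hx i).1, (hx i).2, (hy i).1, (hy i).2]

lemma measurable_cubeAverage (δ : ℝ) (u : (Fin n → ℝ) → ℝ) : Measurable (cubeAverage δ u) :=
  (measurable_of_countable fun z : Fin n → ℤ =>
    (δ ^ n)⁻¹ * ∫ y in cubeIndex δ ⁻¹' {z}, u y).comp (measurable_cubeIndex δ)

lemma enorm_sub_cubeAverage_le {u : (Fin n → ℝ) → ℝ} (hu : Integrable u) {δ : ℝ} (hδ : 0 < δ)
    (x : Fin n → ℝ) :
    ‖u x - cubeAverage δ u x‖ₑ ≤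
      ENNReal.ofReal (δ ^ n)⁻¹ * ∫⁻ h in Metric.closedBall 0 δ, ‖u x - u (x - h)‖ₑ := by
  set Q : Set (Fin n → ℝ) := cubeIndex δ ⁻¹' {cubeIndex δ x} with hQ
  have hδn : 0 < δ ^ n := pow_pos hδ n
  have hvol : volume Q = ENNReal.ofReal (δ ^ n) := volume_cube hδ _
  have hc : IntegrableOn (fun _ : Fin n → ℝ => u x) Q :=
    integrableOn_const (by rw [hvol]; exact ENNReal.ofReal_ne_top)
  have heq : u x - cubeAverage δ u x = (δ ^ n)⁻¹ * ∫ y in Q, (u x - u y) := by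
    rw [integral_sub hc hu.integrableOn, setIntegral_const, measureReal_def, hvol,
      ENNReal.toReal_ofReal hδn.le, smul_eq_mul, mul_sub, inv_mul_cancel_left₀ hδn.ne']
    rfl
  rw [heq, enorm_mul, Real.enorm_eq_ofReal (inv_nonneg.2 hδn.le)]
  gcongr
  calc ‖∫ y in Q, (u x - u y)‖ₑ ≤ ∫⁻ y in Q, ‖u x - u y‖ₑ := enorm_integral_le_lintegral_enorm _
    _ = ∫⁻ y, Q.indicator (fun y => ‖u x - u y‖ₑ) y :=
        (lintegral_indicator (measurableSet_cube _ _) _).symm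
    _ = ∫⁻ h, Q.indicator (fun y => ‖u x - u y‖ₑ) (x - h) :=
        (lintegral_sub_left_eq_self _ x).symm
    _ ≤ ∫⁻ h, (Metric.closedBall 0 δ).indicator (fun h => ‖u x - u (x - h)‖ₑ) h := by
        refine lintegral_mono fun h => ?_
        by_cases hh : x - h ∈ Q
        · have : h ∈ Metric.closedBall (0 : Fin n → ℝ) δ := by
            have := norm_sub_le_of_cubeIndex_eq hδ (x := x) (y := x - h) hh
            simpa using this
          simp only [indicator_of_mem hh, indicator_of_mem this, le_refl]
        · simp only [indicator_of_notMem hh, zero_le]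
    _ = ∫⁻ h in Metric.closedBall 0 δ, ‖u x - u (x - h)‖ₑ :=
        lintegral_indicator Metric.isClosed_closedBall.measurableSet _

lemma lintegral_enorm_sub_cubeAverage_le {u : (Fin n → ℝ) → ℝ} (hu : Integrable u) {δ : ℝ}
    (hδ : 0 < δ) {K : ℝ≥0∞} (hK : ∀ h, ‖h‖ ≤ δ → ∫⁻ x, ‖u x - u (x - h)‖ₑ ≤ K) :
    ∫⁻ x, ‖u x - cubeAverage δ u x‖ₑ ≤ 2 ^ n * K := by
  have hδn : 0 < δ ^ n := pow_pos hδ n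
  set B : Set (Fin n → ℝ) := Metric.closedBall 0 δ with hB
  have hmeas : AEMeasurable (fun p : (Fin n → ℝ) × (Fin n → ℝ) => ‖u p.1 - u (p.1 - p.2)‖ₑ)
      (volume.prod (volume.restrict B)) := by
    have h1 : AEStronglyMeasurable (fun p : (Fin n → ℝ) × (Fin n → ℝ) => u p.1)
        (volume.prod (volume.restrict B)) := hu.aestronglyMeasurable.comp_fst
    have h2 : AEStronglyMeasurable (fun p : (Fin n → ℝ) × (Fin n → ℝ) => u (p.1 - p.2))
        (volume.prod (volume.restrict B)) :=
      hu.aestronglyMeasurable.comp_quasiMeasurePreserving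
        (quasiMeasurePreserving_sub_of_right_invariant volume _)
    exact (h1.sub h2).enorm
  calc ∫⁻ x, ‖u x - cubeAverage δ u x‖ₑ
      ≤ ∫⁻ x, ENNReal.ofReal (δ ^ n)⁻¹ * ∫⁻ h in B, ‖u x - u (x - h)‖ₑ :=
        lintegral_mono fun x => enorm_sub_cubeAverage_le hu hδ x
    _ = ENNReal.ofReal (δ ^ n)⁻¹ * ∫⁻ h in B, ∫⁻ x, ‖u x - u (x - h)‖ₑ := by
        rw [lintegral_const_mul' _ _ ENNReal.ofReal_ne_top, lintegral_lintegral_swap hmeas]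
    _ ≤ ENNReal.ofReal (δ ^ n)⁻¹ * ∫⁻ _ in B, K := by
        gcongr _ * ?_
        refine setLIntegral_mono' Metric.isClosed_closedBall.measurableSet fun h hh => hK h ?_
        simpa [hB] using hh
    _ = 2 ^ n * K := by
        rw [setLIntegral_const, hB, Real.volume_pi_closedBall _ hδ.le, Fintype.card_fin, mul_pow,
          ENNReal.ofReal_mul (by positivity), mul_comm K, ← mul_assoc, mul_left_comm,
          ← ENNReal.ofReal_mul (inv_nonneg.2 hδn.le), inv_mul_cancel₀ hδn.ne',
          ENNReal.ofReal_one, mul_one, ENNReal.ofReal_pow zero_le_two]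
        simp

end CubeAverage

section Compactness

variable {n : ℕ}

lemma norm_integral_le_of_integral_norm_le {u : (Fin n → ℝ) → ℝ} (hu : Integrable u) {M : ℝ}
    (hM : ∫ x, ‖u x‖ ≤ M) (s : Set (Fin n → ℝ)) : ‖∫ x in s, u x‖ ≤ M :=
  (norm_integral_le_integral_norm _).trans
    ((setIntegral_le_integral hu.norm (.of_forall fun _ => norm_nonneg _)).trans hM)

/-- A diagonal argument: along a subsequence, the averages on all the cubes of countably many grids
converge. -/
lemma exists_subseq_tendsto_cubeAverage (δ : ℕ → ℝ) {v : ℕ → (Fin n → ℝ) → ℝ}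
    (hv : ∀ j, Integrable (v j)) {M : ℝ} (hM : ∀ j, ∫ x, ‖v j x‖ ≤ M) :
    ∃ ns : ℕ → ℕ, StrictMono ns ∧ ∃ g : ℕ → (Fin n → ℝ) → ℝ,
      ∀ k x, Tendsto (fun j => cubeAverage (δ k) (v (ns j)) x) atTop (𝓝 (g k x)) := by
  obtain ⟨a, -, ns, hns, ha⟩ := (isCompact_univ_pi fun _ : ℕ × (Fin n → ℤ) =>
    isCompact_closedBall (0 : ℝ) M).tendsto_subseq
    (x := fun j p => ∫ y in cubeIndex (δ p.1) ⁻¹' {p.2}, v j y) fun j p _ => by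
      simpa using norm_integral_le_of_integral_norm_le (hv j) (hM j) _
  refine ⟨ns, hns, fun k x => (δ k ^ n)⁻¹ * a (k, cubeIndex (δ k) x), fun k x => ?_⟩
  exact ((tendsto_pi_nhds.1 ha) (k, cubeIndex (δ k) x)).const_mul _

lemma norm_cubeAverage_le {u : (Fin n → ℝ) → ℝ} (hu : Integrable u) {M : ℝ}
    (hM : ∫ x, ‖u x‖ ≤ M) {δ : ℝ} (hδ : 0 < δ) (x : Fin n → ℝ) :
    ‖cubeAverage δ u x‖ ≤ (δ ^ n)⁻¹ * M := by
  have : 0 ≤ (δ ^ n)⁻¹ := inv_nonneg.2 (pow_pos hδ n).le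
  rw [cubeAverage, norm_mul, Real.norm_of_nonneg this]
  exact mul_le_mul_of_nonneg_left (norm_integral_le_of_integral_norm_le hu hM _) this

/-- Compactness in `L¹` of functions supported in a set of finite measure whose translations are
uniformly Lipschitz in `L¹`. -/
lemma exists_subseq_tendsto_eLpNorm {Ω : Set (Fin n → ℝ)} (hΩ : MeasurableSet Ω)
    (hΩfin : volume Ω ≠ ⊤) {v : ℕ → (Fin n → ℝ) → ℝ} (hv : ∀ j, Integrable (v j)) {M : ℝ}
    (hM : ∀ j, ∫ x, ‖v j x‖ ≤ M) (hsupp : ∀ j, ∀ᵐ x, x ∉ Ω → v j x = 0) {C : ℝ}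
    (hC : ∀ j h, ∫⁻ x, ‖v j x - v j (x - h)‖ₑ ≤ ENNReal.ofReal (C * ‖h‖)) (hC0 : 0 ≤ C) :
    ∃ ns : ℕ → ℕ, StrictMono ns ∧ ∃ u : (Fin n → ℝ) → ℝ, Integrable u ∧
      Tendsto (fun j => eLpNorm (v (ns j) - u) 1 volume) atTop (𝓝 0) := by
  set δ : ℕ → ℝ := fun k => 1 / ((k : ℝ) + 1) with hδ
  have hδ0 : ∀ k, 0 < δ k := fun k => by positivity
  obtain ⟨ns, hns, g, hg⟩ := exists_subseq_tendsto_cubeAverage δ hv hM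
  have hgm : ∀ k, Measurable (g k) := fun k =>
    measurable_of_tendsto_metrizable (fun j => measurable_cubeAverage (δ k) (v (ns j)))
      (tendsto_pi_nhds.2 (hg k))
  have hmem : ∀ j, MemLp (v (ns j)) 1 volume := fun j => memLp_one_iff_integrable.2 (hv _)
  have hA : ∀ k j, ∫⁻ x, ‖v (ns j) x - cubeAverage (δ k) (v (ns j)) x‖ₑ ≤
      2 ^ n * ENNReal.ofReal (C * δ k) := fun k j =>
    lintegral_enorm_sub_cubeAverage_le (hv _) (hδ0 k) fun h hh =>
      (hC _ h).trans (ENNReal.ofReal_le_ofReal (by gcongr))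
  have hAlim : Tendsto (fun k => 2 ^ n * ENNReal.ofReal (C * δ k)) atTop (𝓝 0) := by
    have h1 : Tendsto (fun k => ENNReal.ofReal (C * δ k)) atTop (𝓝 0) := by
      simpa [hδ] using ENNReal.tendsto_ofReal
        ((tendsto_one_div_add_atTop_nhds_zero_nat (𝕜 := ℝ)).const_mul C)
    simpa using ENNReal.Tendsto.const_mul h1 (.inr (by finiteness))
  have hG : ∀ k, Tendsto (fun j => ∫⁻ x in Ω, ‖cubeAverage (δ k) (v (ns j)) x - g k x‖ₑ) atTop
      (𝓝 0) := fun k => by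
    have hle : ∀ x, ‖g k x‖ ≤ (δ k ^ n)⁻¹ * M := fun x =>
      le_of_tendsto' (hg k x).norm fun j => norm_cubeAverage_le (hv _) (hM _) (hδ0 k) x
    have := tendsto_lintegral_of_dominated_convergence
      (F := fun j x => ‖cubeAverage (δ k) (v (ns j)) x - g k x‖ₑ) (f := fun _ => 0)
      (μ := volume.restrict Ω)
      (fun _ => ENNReal.ofReal ((δ k ^ n)⁻¹ * M) + ENNReal.ofReal ((δ k ^ n)⁻¹ * M))
      (fun j => ((measurable_cubeAverage _ _).sub (hgm k)).enorm)
      (fun j => .of_forall fun x => enorm_sub_le.trans (add_le_add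
        (by
          rw [← ofReal_norm]
          exact ENNReal.ofReal_le_ofReal (norm_cubeAverage_le (hv _) (hM _) (hδ0 k) x))
        (by
          rw [← ofReal_norm]
          exact ENNReal.ofReal_le_ofReal (hle x))))
      (by
        rw [setLIntegral_const]
        exact ENNReal.mul_ne_top (by finiteness) hΩfin)
      (.of_forall fun x => by
        have h0 : Tendsto (fun j => cubeAverage (δ k) (v (ns j)) x - g k x) atTop (𝓝 0) := by
          simpa using (hg k x).sub_const (g k x)
        simpa using h0.enorm)
    simpa using this
  have hdist : ∀ k i, ∫⁻ x in Ω, ‖v (ns i) x - g k x‖ₑ ≤ 2 ^ n * ENNReal.ofReal (C * δ k) +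
      ∫⁻ x in Ω, ‖cubeAverage (δ k) (v (ns i)) x - g k x‖ₑ := fun k i => by
    refine le_trans ?_ (add_le_add_left ((setLIntegral_le_lintegral Ω _).trans (hA k i)) _)
    have hm : Measurable fun x => ‖cubeAverage (δ k) (v (ns i)) x - g k x‖ₑ :=
      ((measurable_cubeAverage _ _).sub (hgm k)).enorm
    rw [← lintegral_add_right _ hm]
    exact lintegral_mono fun x => by
      simpa using enorm_add_le (v (ns i) x - cubeAverage (δ k) (v (ns i)) x)
        (cubeAverage (δ k) (v (ns i)) x - g k x)
  have hsub : ∀ k i j, eLpNorm (v (ns i) - v (ns j)) 1 volume ≤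
      (∫⁻ x in Ω, ‖v (ns i) x - g k x‖ₑ) + ∫⁻ x in Ω, ‖v (ns j) x - g k x‖ₑ := fun k i j => by
    have hm : AEMeasurable (fun x => ‖v (ns i) x - g k x‖ₑ) (volume.restrict Ω) :=
      ((hv (ns i)).aestronglyMeasurable.restrict.sub (hgm k).aestronglyMeasurable).enorm
    rw [eLpNorm_one_eq_lintegral_enorm, ← lintegral_add_left' hm]
    have : ∫⁻ x, ‖(v (ns i) - v (ns j)) x‖ₑ = ∫⁻ x in Ω, ‖(v (ns i) - v (ns j)) x‖ₑ := by
      rw [← lintegral_indicator hΩ]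
      refine lintegral_congr_ae ?_
      filter_upwards [hsupp (ns i), hsupp (ns j)] with x hi hj
      by_cases hx : x ∈ Ω
      · simp [hx]
      · simp [hx, hi hx, hj hx]
    rw [this]
    exact lintegral_mono fun x => by
      simpa using enorm_sub_le (a := v (ns i) x - g k x) (b := v (ns j) x - g k x)
  have hcau : CauchySeq fun j => (hmem j).toLp (v (ns j)) := by
    refine EMetric.cauchySeq_iff.2 fun ε hε => ?_
    have hε4 : 0 < ε / 2 / 2 := ENNReal.half_pos (ENNReal.half_pos hε.ne').ne'
    obtain ⟨k, hk⟩ := (hAlim.eventually (gt_mem_nhds hε4)).exists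
    obtain ⟨N, hN⟩ := eventually_atTop.1 ((hG k).eventually (gt_mem_nhds hε4))
    have hlt : ∀ i, N ≤ i → ∫⁻ x in Ω, ‖v (ns i) x - g k x‖ₑ < ε / 2 := fun i hi =>
      (hdist k i).trans_lt (by
        rw [← ENNReal.add_halves (ε / 2)]
        exact ENNReal.add_lt_add hk (hN i hi))
    refine ⟨N, fun i hi j hj => ?_⟩
    rw [Lp.edist_toLp_toLp]
    refine (hsub k i j).trans_lt ?_
    rw [← ENNReal.add_halves ε]
    exact ENNReal.add_lt_add (hlt i hi) (hlt j hj)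
  obtain ⟨f, hf⟩ := cauchySeq_tendsto_of_complete hcau
  refine ⟨ns, hns, f, memLp_one_iff_integrable.1 (Lp.memLp f), ?_⟩
  rw [← Lp.toLp_coeFn f (Lp.memLp f)] at hf
  exact (Lp.tendsto_Lp_iff_tendsto_eLpNorm'' _ hmem _ (Lp.memLp f)).1 hf

end Compactness

section LowerSemicontinuity

variable {n : ℕ} {φ : (Fin n → ℝ) → ℝ} {u : (Fin n → ℝ) → ℝ} {v : ℕ → (Fin n → ℝ) → ℝ}

lemma tendsto_integral_mul_of_tendsto_eLpNorm (hv : ∀ j, Integrable (v j)) (hu : Integrable u)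
    (h : Tendsto (fun j => eLpNorm (v j - u) 1 volume) atTop (𝓝 0)) {w : (Fin n → ℝ) → ℝ}
    (hw : Continuous w) {C : ℝ} (hC : ∀ x, ‖w x‖ ≤ C) :
    Tendsto (fun j => ∫ x, v j x * w x) atTop (𝓝 (∫ x, u x * w x)) := by
  have hi : ∀ f : (Fin n → ℝ) → ℝ, Integrable f → Integrable (fun x => f x * w x) := fun f hf =>
    hf.mul_bdd hw.aestronglyMeasurable (.of_forall hC)
  refine tendsto_integral_of_L1 _ (hi u hu).aestronglyMeasurable (.of_forall fun j => hi _ (hv j)) ?_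
  have hlim : Tendsto (fun j => eLpNorm (v j - u) 1 volume * ENNReal.ofReal C) atTop (𝓝 0) := by
    simpa using ENNReal.Tendsto.mul_const h (.inr ENNReal.ofReal_ne_top)
  refine tendsto_of_tendsto_of_tendsto_of_le_of_le tendsto_const_nhds hlim (fun _ => zero_le)
    fun j => ?_
  change ∫⁻ x, ‖v j x * w x - u x * w x‖ₑ ≤ eLpNorm (v j - u) 1 volume * ENNReal.ofReal C
  rw [eLpNorm_one_eq_lintegral_enorm, ← lintegral_mul_const' _ _ ENNReal.ofReal_ne_top]
  refine lintegral_mono fun x => ?_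
  rw [← sub_mul, enorm_mul]
  gcongr
  · exact le_rfl
  · rw [← ofReal_norm]
    exact ENNReal.ofReal_le_ofReal (hC x)

lemma anisoTV_le_of_tendsto_eLpNorm (hv : ∀ j, Integrable (v j)) (hu : Integrable u)
    (h : Tendsto (fun j => eLpNorm (v j - u) 1 volume) atTop (𝓝 0)) {I : ℝ≥0∞}
    (hI : Tendsto (fun j => anisoTV φ (v j)) atTop (𝓝 I)) : anisoTV φ u ≤ I := by
  refine iSup₂_le fun η hη => ?_
  obtain ⟨C, hC⟩ := exists_norm_diverg_le hη.1 hη.2.1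
  refine le_of_tendsto_of_tendsto' (ENNReal.tendsto_ofReal
    (tendsto_integral_mul_of_tendsto_eLpNorm hv hu h (continuous_diverg hη.1) hC)) hI fun j => ?_
  exact le_iSup₂_of_le η hη le_rfl

end LowerSemicontinuity

section Competitor

/-- Multiples of characteristic functions of boxes have finite total variation. -/
lemma anisoTV_indicator_Icc_ne_top {d : ℕ} {φ : (Fin (d + 1) → ℝ) → ℝ} (hφ : IsNorm φ)
    {a b : Fin (d + 1) → ℝ} (hab : a ≤ b) {c : ℝ} (hc : 0 ≤ c) :
    anisoTV φ ((Icc a b).indicator fun _ => c) ≠ ⊤ := by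
  obtain ⟨κ, hκ0, hκ⟩ := hφ.exists_norm_le_mul
  refine ne_top_of_le_ne_top (ENNReal.ofReal_ne_top (r := c * ∑ i : Fin (d + 1),
    (κ * volume.real (Icc (a ∘ i.succAbove) (b ∘ i.succAbove)) +
      κ * volume.real (Icc (a ∘ i.succAbove) (b ∘ i.succAbove))))) (iSup₂_le fun η hη => ?_)
  obtain ⟨hη1, -, hη3⟩ := hη
  refine ENNReal.ofReal_le_ofReal ?_
  have hbd : ∀ x i, ‖η x i‖ ≤ κ := fun x i =>
    (norm_le_pi_norm (η x) i).trans ((hκ _).trans (mul_le_of_le_one_right hκ0 (hη3 x)))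
  have hind : (fun x => (Icc a b).indicator (fun _ => c) x * diverg η x) =
      (Icc a b).indicator fun x => c * diverg η x := by
    ext x
    by_cases hx : x ∈ Icc a b <;> simp [hx]
  rw [hind, integral_indicator measurableSet_Icc, integral_const_mul]
  gcongr
  have hdiv := integral_divergence_of_hasFDerivAt_off_countable a b hab η (fderiv ℝ η) ∅
    countable_empty hη1.continuous.continuousOn
    (fun x _ => (hη1.differentiable one_ne_zero x).hasFDerivAt)
    (continuous_diverg hη1).continuousOn.integrableOn_Icc
  change ∫ x in Icc a b, ∑ i, fderiv ℝ η x (Pi.single i 1) i ≤ _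
  rw [hdiv]
  refine Finset.sum_le_sum fun i _ => ?_
  have hface : ∀ y : (Fin d → ℝ) → Fin (d + 1) → ℝ,
      ‖∫ x in Icc (a ∘ i.succAbove) (b ∘ i.succAbove), η (y x) i‖ ≤
        κ * volume.real (Icc (a ∘ i.succAbove) (b ∘ i.succAbove)) := fun y =>
    norm_setIntegral_le_of_norm_le_const isCompact_Icc.measure_lt_top fun x _ => hbd _ _
  refine (le_abs_self _).trans ((abs_sub _ _).trans (add_le_add (hface _) (hface _)))

lemma exists_admissible {n : ℕ} (hn : 1 ≤ n) {φ : (Fin n → ℝ) → ℝ} (hφ : IsNorm φ)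
    {Ω : Set (Fin n → ℝ)} (hΩopen : IsOpen Ω) (hΩne : Ω.Nonempty) {m : ℝ} (hm : 0 ≤ m) :
    ∃ u, Admissible φ Ω m u := by
  obtain ⟨d, rfl⟩ : ∃ d, n = d + 1 := ⟨n - 1, by omega⟩
  obtain ⟨x₀, hx₀⟩ := hΩne
  obtain ⟨r, hr, hball⟩ := Metric.nhds_basis_closedBall.mem_iff.1 (hΩopen.mem_nhds hx₀)
  obtain ⟨k, hk⟩ := exists_nat_gt (m / r ^ (d + 1))
  have hrd : 0 < r ^ (d + 1) := pow_pos hr _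
  have hk0 : (0 : ℝ) < k := (div_nonneg hm hrd.le).trans_lt hk
  set s : ℝ := (m / k) ^ ((d + 1 : ℕ) : ℝ)⁻¹ with hs
  have hmk : 0 ≤ m / k := div_nonneg hm hk0.le
  have hs0 : 0 ≤ s := Real.rpow_nonneg hmk _
  have hsn : s ^ (d + 1) = m / k := Real.rpow_inv_natCast_pow hmk (Nat.succ_ne_zero d)
  have hsr : s ≤ r := by
    refine le_of_pow_le_pow_left₀ (Nat.succ_ne_zero d) hr.le ?_
    rw [hsn, div_le_iff₀ hk0, mul_comm, ← div_le_iff₀ hrd]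
    exact hk.le
  set b : Fin (d + 1) → ℝ := fun i => x₀ i + s with hb
  have hab : x₀ ≤ b := fun i => by simp [hb, hs0]
  have hsub : Icc x₀ b ⊆ Ω := fun y hy => hball (by
    rw [Metric.mem_closedBall, dist_pi_le_iff hr.le]
    intro i
    have h1 := hy.1 i
    have h2 : y i ≤ x₀ i + s := hy.2 i
    rw [Real.dist_eq, abs_of_nonneg (sub_nonneg.2 h1)]
    linarith)
  have hvol : volume.real (Icc x₀ b) = m / k := by
    rw [measureReal_def, Real.volume_Icc_pi_toReal hab]
    simp [hb, hsn]
  refine ⟨(Icc x₀ b).indicator fun _ => (k : ℝ), ⟨?_, ?_⟩, ?_, ?_, ?_⟩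
  · exact (integrable_indicator_iff measurableSet_Icc).2
      (integrableOn_const isCompact_Icc.measure_lt_top.ne)
  · exact anisoTV_indicator_Icc_ne_top hφ hab hk0.le
  · exact .of_forall fun x hx => indicator_of_notMem (fun h => hx (hsub h)) _
  · refine .of_forall fun x => ?_
    by_cases hx : x ∈ Icc x₀ b
    · exact ⟨k, indicator_of_mem hx _⟩
    · exact ⟨0, by simp [hx]⟩
  · rw [setIntegral_indicator measurableSet_Icc, inter_eq_self_of_subset_right hsub,
      setIntegral_const, hvol, smul_eq_mul, div_mul_cancel₀ _ hk0.ne']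

end Competitor

section Minimizer

variable {n : ℕ} {φ : (Fin n → ℝ) → ℝ} {Ω : Set (Fin n → ℝ)} {m : ℝ}

lemma Admissible.integral_norm_eq {u : (Fin n → ℝ) → ℝ} (hu : Admissible φ Ω m u) :
    ∫ x, ‖u x‖ = m := by
  obtain ⟨-, h0, hN, hm⟩ := hu
  rw [← hm, setIntegral_eq_integral_of_ae_compl_eq_zero h0]
  refine integral_congr_ae ?_
  filter_upwards [hN] with x hx
  obtain ⟨k, hk⟩ := hx
  simp [hk]

lemma admissible_of_tendsto_eLpNorm {u : (Fin n → ℝ) → ℝ} {v : ℕ → (Fin n → ℝ) → ℝ}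
    (hv : ∀ j, Admissible φ Ω m (v j)) (hu : Integrable u) (hTV : anisoTV φ u ≠ ⊤)
    (h : Tendsto (fun j => eLpNorm (v j - u) 1 volume) atTop (𝓝 0)) : Admissible φ Ω m u := by
  obtain ⟨ns, -, hae⟩ := (tendstoInMeasure_of_tendsto_eLpNorm one_ne_zero
    (fun j => (hv j).1.1.aestronglyMeasurable) hu.aestronglyMeasurable h).exists_seq_tendsto_ae
  have h0 : ∀ᵐ x, x ∉ Ω → u x = 0 := by
    filter_upwards [hae, ae_all_iff.2 fun j => (hv j).2.1] with x hx hx0 hxΩ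
    refine tendsto_nhds_unique hx ?_
    simp only [hx0 _ hxΩ, tendsto_const_nhds]
  refine ⟨⟨hu, hTV⟩, h0, ?_, ?_⟩
  · filter_upwards [hae, ae_all_iff.2 fun j => (hv j).2.2.1] with x hx hxN
    have : u x ∈ range ((↑) : ℕ → ℝ) :=
      Nat.isClosedEmbedding_coe_real.isClosed_range.mem_of_tendsto hx
        (.of_forall fun j => (hxN (ns j)).imp fun k hk => hk.symm)
    exact this.imp fun k hk => hk.symm
  · rw [setIntegral_eq_integral_of_ae_compl_eq_zero h0]
    have := tendsto_integral_mul_of_tendsto_eLpNorm (fun j => (hv j).1.1) hu h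
      (continuous_const (y := (1 : ℝ))) (C := 1) (by simp)
    simp only [mul_one] at this
    refine tendsto_nhds_unique this ?_
    have hj : ∀ j, ∫ x, v j x = m := fun j => by
      rw [← setIntegral_eq_integral_of_ae_compl_eq_zero (hv j).2.1]
      exact (hv j).2.2.2
    simp only [hj, tendsto_const_nhds]

end Minimizer

/-- Existence of minimizers of problem (1). -/
theorem existence_of_minimizers {n : ℕ} (hn : 1 ≤ n)
    (φ : (Fin n → ℝ) → ℝ) (hφ : IsNorm φ)
    (Ω : Set (Fin n → ℝ)) (hΩopen : IsOpen Ω) (hΩne : Ω.Nonempty)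
    (hΩfin : volume Ω ≠ ⊤) (m : ℝ) (hm : 0 ≤ m) :
    ∃ u : (Fin n → ℝ) → ℝ, IsMinimizer φ Ω m u := by
  obtain ⟨w, hw⟩ := exists_admissible hn hφ hΩopen hΩne hm
  obtain ⟨t, htanti, htlim, htmem⟩ :=
    exists_seq_tendsto_sInf (S := anisoTV φ '' {v | Admissible φ Ω m v}) ⟨_, w, hw, rfl⟩
      (OrderBot.bddBelow _)
  choose v hv hvt using htmem
  obtain ⟨κ, hκ0, hκ⟩ := hφ.exists_le_mul_norm
  have ht0 : t 0 ≠ ⊤ := hvt 0 ▸ (hv 0).1.2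
  obtain ⟨ns, hns, u, hu, hlim⟩ := exists_subseq_tendsto_eLpNorm hΩopen.measurableSet hΩfin
    (fun j => (hv j).1.1) (fun j => (hv j).integral_norm_eq.le) (fun j => (hv j).2.1)
    (C := κ * (t 0).toReal) (fun j h => by
      refine (lintegral_enorm_translate_sub_le hφ (hv j).1.1 (hv j).1.2 h).trans
        (ENNReal.ofReal_le_ofReal ?_)
      rw [mul_right_comm]
      have : (anisoTV φ (v j)).toReal ≤ (t 0).toReal :=
        ENNReal.toReal_mono ht0 ((hvt j).trans_le (htanti (Nat.zero_le j)))
      gcongr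
      exact hκ h) (mul_nonneg hκ0 ENNReal.toReal_nonneg)
  have hle : anisoTV φ u ≤ sInf (anisoTV φ '' {v | Admissible φ Ω m v}) := by
    refine anisoTV_le_of_tendsto_eLpNorm (fun j => (hv (ns j)).1.1) hu hlim ?_
    simp only [hvt]
    exact htlim.comp hns.tendsto_atTop
  have hmin : ∀ v, Admissible φ Ω m v → anisoTV φ u ≤ anisoTV φ v := fun v hv =>
    hle.trans (sInf_le ⟨v, hv, rfl⟩)
  exact ⟨u, admissible_of_tendsto_eLpNorm (fun j => hv (ns j)) hu
    (ne_top_of_le_ne_top hw.1.2 (hmin w hw)) hlim, hmin⟩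

end
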